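/- arXiv:2112.03543 — 6 statements merged into one kernel-verified Lean document; each statement's English description precedes it below -/
import Mathlib

section
/- For the 3-Majority dynamics with uniform noise probability p ∈ (0,1), the conditional expectation of the bias satisfies E[s_t | s_{t−1} = s] = (s(1−p)/2)·(3 − (s²/n²)(1−p)²) for every s ∈ {−n, …, n}. -/
/-- The probability that a fixed node adopts opinion `beta` in one round of the
`3-Majority` dynamics with uniform communication noise probability `p`, on the complete
graph on `n` nodes, given that the current bias (#beta − #alpha) is `s`.
With `b' = ((n+s)/(2n))·(1−p) + p/2` and `a' = ((n−s)/(2n))·(1−p) + p/2`, it equals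
`b'^3 + 3·a'·b'^2`. -/
noncomputable def qStep (n : ℕ) (p : ℝ) (s : ℤ) : ℝ :=
  ((((n : ℝ) + (s : ℝ)) / (2 * (n : ℝ))) * (1 - p) + p / 2) ^ 3 +
    3 * ((((n : ℝ) - (s : ℝ)) / (2 * (n : ℝ))) * (1 - p) + p / 2) *
      ((((n : ℝ) + (s : ℝ)) / (2 * (n : ℝ))) * (1 - p) + p / 2) ^ 2

/-- Probability that `b_t = k` (i.e. exactly `k` nodes adopt beta), given `s_{t-1} = s`:
the binomial distribution `Binomial(n, qStep n p s)`. -/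
noncomputable def binomProb (n : ℕ) (p : ℝ) (s : ℤ) (k : ℕ) : ℝ :=
  (n.choose k : ℝ) * qStep n p s ^ k * (1 - qStep n p s) ^ (n - k)

open scoped Classical in
/-- One-step probability of the event `A` for the new bias `s_t = 2·b_t − n`,
conditional on `s_{t-1} = s`. -/
noncomputable def stepProb (n : ℕ) (p : ℝ) (s : ℤ) (A : ℤ → Prop) : ℝ :=
  ∑ k ∈ Finset.range (n + 1), if A (2 * (k : ℤ) - (n : ℤ)) then binomProb n p s k else 0

/-- One-step expectation of `f (s_t)` conditional on `s_{t-1} = s`. -/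
noncomputable def stepExp (n : ℕ) (p : ℝ) (s : ℤ) (f : ℤ → ℝ) : ℝ :=
  ∑ k ∈ Finset.range (n + 1), binomProb n p s k * f (2 * (k : ℤ) - (n : ℤ))

/-- The equilibrium bias `s_eq = (n/(1−p))·√((1−3p)/(1−p))`. -/
noncomputable def sEq (n : ℕ) (p : ℝ) : ℝ :=
  ((n : ℝ) / (1 - p)) * Real.sqrt ((1 - 3 * p) / (1 - p))

/-- Bias trajectory: `ω t` records the number of beta-nodes at round `t+1`;
the bias at time `0` is `s0` and at time `t+1` it is `2·(ω t) − n`. -/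
def biasAt (n : ℕ) (s0 : ℤ) (ω : ℕ → Fin (n + 1)) : ℕ → ℤ
  | 0 => s0
  | t + 1 => 2 * ((ω t).val : ℤ) - (n : ℤ)

/-- Probability of the first `t` steps of the trajectory `ω` of the Markov chain started
at bias `s0` (product of one-step binomial probabilities). -/
noncomputable def trajP (n : ℕ) (p : ℝ) (s0 : ℤ) (ω : ℕ → Fin (n + 1)) : ℕ → ℝ
  | 0 => 1
  | t + 1 => trajP n p s0 ω t * binomProb n p (biasAt n s0 ω t) (ω t).val

/-- Extend a finite path to an infinite one (junk after time `T`). -/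
def extendPath (n T : ℕ) (ω : Fin T → Fin (n + 1)) : ℕ → Fin (n + 1) :=
  fun t => if h : t < T then ω ⟨t, h⟩ else 0

open scoped Classical in
/-- Probability that the bias trajectory `(s_0, s_1, …, s_T)` of the 3-Majority Markov
chain with noise `p`, started from `s_0 = s0`, satisfies the event `E`. -/
noncomputable def trajProb (n : ℕ) (p : ℝ) (s0 : ℤ) (T : ℕ) (E : (ℕ → ℤ) → Prop) : ℝ :=
  ∑ ω : Fin T → Fin (n + 1),
    if E (biasAt n s0 (extendPath n T ω)) then trajP n p s0 (extendPath n T ω) T else 0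

/-- Lemma: expected bias. For the 3-Majority dynamics with uniform
noise probability `p ∈ (0,1)`, for every bias value `s ∈ {−n, …, n}`,
`E[s_t | s_{t−1} = s] = (s(1−p)/2)·(3 − (s²/n²)(1−p)²)`. -/
theorem expected_bias
    (n : ℕ) (hn : 0 < n) (p : ℝ) (hp0 : 0 < p) (hp1 : p < 1)
    (s : ℤ) (hs_lb : -(n : ℤ) ≤ s) (hs_ub : s ≤ (n : ℤ)) :
    stepExp n p s (fun x => (x : ℝ)) =
      (s : ℝ) * (1 - p) / 2 * (3 - (s : ℝ) ^ 2 / (n : ℝ) ^ 2 * (1 - p) ^ 2) := by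
  have hn' : (n : ℝ) ≠ 0 := by exact_mod_cast hn.ne'
  have h0 : ∑ k ∈ Finset.range (n + 1), binomProb n p s k = 1 := by
    have h := congrArg (Polynomial.eval (qStep n p s)) (bernsteinPolynomial.sum ℝ n)
    simpa [Polynomial.eval_finset_sum, bernsteinPolynomial, binomProb] using h
  have h1 : ∑ k ∈ Finset.range (n + 1), (k : ℝ) * binomProb n p s k = n * qStep n p s := by
    have h := congrArg (Polynomial.eval (qStep n p s)) (bernsteinPolynomial.sum_smul ℝ n)
    simpa [Polynomial.eval_finset_sum, bernsteinPolynomial, binomProb] using h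
  have h2 : stepExp n p s (fun x => (x : ℝ)) =
      2 * ∑ k ∈ Finset.range (n + 1), (k : ℝ) * binomProb n p s k -
        n * ∑ k ∈ Finset.range (n + 1), binomProb n p s k := by
    unfold stepExp
    rw [Finset.mul_sum, Finset.mul_sum, ← Finset.sum_sub_distrib]
    refine Finset.sum_congr rfl fun k _ => ?_
    push_cast
    ring
  rw [h2, h1, h0]
  unfold qStep
  field_simp
  ring
end

section
/- (Victory of the majority.) Let p < 1/3, let ε > 0 be a constant with ε < 1/3 and ε² ≤ (1−3p)/2, and let γ > 0 be a constant. For the 3-Majority dynamics with uniform noise probability p, for any starting configuration with s_0 ≥ γ·√(n·log n) and all sufficiently large n, with high probability: (i) there exists a time τ₁ = O_{γ,ε,p}(log n) such that (1−ε)·s_eq ≤ s_{τ₁} ≤ (1+ε)·s_eq; and (ii) there exists a constant c = Θ_{γ,ε,p}(1) such that for all k ≤ n^c, (1−ε)·s_eq ≤ s_{τ₁+k} ≤ (1+ε)·s_eq. -/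
/-- Normalized drift. -/
noncomputable def gDrift (p x : ℝ) : ℝ := (1 - p) * x * (3 - ((1 - p) * x) ^ 2) / 2

lemma qStep_eq (n : ℕ) (hn : 0 < n) (p : ℝ) (s : ℤ) :
    2 * qStep n p s - 1 = gDrift p ((s : ℝ) / n) := by
  have : (n : ℝ) ≠ 0 := by positivity
  unfold qStep gDrift
  field_simp
  ring

lemma gDrift_abs (p x : ℝ) (hp0 : 0 < p) (hp : p < 1 / 3) (hx : |x| ≤ 1) :
    |gDrift p x| ≤ 1 := by
  unfold gDrift
  obtain ⟨h1, h2⟩ := abs_le.mp hx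
  have hy1 : -1 ≤ (1 - p) * x := by nlinarith
  have hy2 : (1 - p) * x ≤ 1 := by nlinarith
  generalize (1 - p) * x = y at *
  rw [abs_le]
  constructor
  · nlinarith [mul_nonneg (sq_nonneg (y + 1)) (by linarith : 0 ≤ 2 - y)]
  · nlinarith [mul_nonneg (sq_nonneg (y - 1)) (by linarith : 0 ≤ 2 + y)]

lemma qStep_mem (n : ℕ) (hn : 0 < n) (p : ℝ) (hp0 : 0 < p) (hp : p < 1 / 3) (s : ℤ)
    (hs : |s| ≤ (n : ℤ)) : 0 ≤ qStep n p s ∧ qStep n p s ≤ 1 := by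
  have hn' : (0 : ℝ) < n := by positivity
  have h1 : |(s : ℝ) / n| ≤ 1 := by
    rw [abs_div, abs_of_pos hn', div_le_one hn']
    exact_mod_cast hs
  have h2 := abs_le.mp (gDrift_abs p _ hp0 hp h1)
  rw [← qStep_eq n hn] at h2
  constructor <;> linarith [h2.1, h2.2]

lemma binomProb_nonneg (n : ℕ) (hn : 0 < n) (p : ℝ) (hp0 : 0 < p) (hp : p < 1 / 3) (s : ℤ)
    (hs : |s| ≤ (n : ℤ)) (k : ℕ) : 0 ≤ binomProb n p s k := by
  obtain ⟨h1, h2⟩ := qStep_mem n hn p hp0 hp s hs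
  have : 0 ≤ 1 - qStep n p s := by linarith
  unfold binomProb
  positivity

lemma bern_mgf (q l : ℝ) (hq0 : 0 ≤ q) (hq1 : q ≤ 1) (hl : |l| ≤ 1) :
    q * Real.exp (l * (1 - q)) + (1 - q) * Real.exp (-(l * q)) ≤ Real.exp (l ^ 2 / 4) := by
  have e1 : |l * (1 - q)| ≤ 1 := by
    rw [abs_mul, abs_of_nonneg (by linarith : 0 ≤ 1 - q)]
    nlinarith [abs_nonneg l]
  have e2 : |-(l * q)| ≤ 1 := by
    rw [abs_neg, abs_mul, abs_of_nonneg hq0]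
    nlinarith [abs_nonneg l]
  have h1 := (abs_le.mp (Real.abs_exp_sub_one_sub_id_le e1)).2
  have h2 := (abs_le.mp (Real.abs_exp_sub_one_sub_id_le e2)).2
  have h3 := Real.add_one_le_exp (l ^ 2 / 4)
  have h4 := mul_le_mul_of_nonneg_left h1 hq0
  have h5 := mul_le_mul_of_nonneg_left h2 (by linarith : 0 ≤ 1 - q)
  nlinarith [mul_nonneg (sq_nonneg l) (sq_nonneg (2 * q - 1))]

lemma binom_mgf (n : ℕ) (hn : 0 < n) (p : ℝ) (hp0 : 0 < p) (hp : p < 1 / 3) (s : ℤ)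
    (hs : |s| ≤ (n : ℤ)) (l : ℝ) (hl : |l| ≤ 1) :
    ∑ k ∈ Finset.range (n + 1), binomProb n p s k * Real.exp (l * (k - n * qStep n p s))
      ≤ Real.exp (n * l ^ 2 / 4) := by
  obtain ⟨h1, h2⟩ := qStep_mem n hn p hp0 hp s hs
  have h3 := bern_mgf _ l h1 h2 hl
  have h4 := pow_le_pow_left₀ (add_nonneg (mul_nonneg h1 (Real.exp_pos _).le)
    (mul_nonneg (by linarith : 0 ≤ 1 - qStep n p s) (Real.exp_pos _).le)) h3 n
  rw [add_pow, ← Real.exp_nat_mul] at h4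
  refine le_trans (le_of_eq ?_) (h4.trans (le_of_eq (by ring_nf)))
  refine Finset.sum_congr rfl fun k hk => ?_
  have hk' : k ≤ n := Nat.lt_succ_iff.mp (Finset.mem_range.mp hk)
  unfold binomProb
  rw [mul_pow, mul_pow, ← Real.exp_nat_mul, ← Real.exp_nat_mul]
  have : Real.exp (l * (k - n * qStep n p s)) =
      Real.exp (k * (l * (1 - qStep n p s))) *
        Real.exp (((n - k : ℕ) : ℝ) * -(l * qStep n p s)) := by
    rw [← Real.exp_add, Nat.cast_sub hk']
    ring_nf
  rw [this]
  ring

lemma binom_sum (n : ℕ) (p : ℝ) (s : ℤ) :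
    ∑ k ∈ Finset.range (n + 1), binomProb n p s k = 1 := by
  have h := (add_pow (qStep n p s) (1 - qStep n p s) n).symm
  rw [add_sub_cancel, one_pow] at h
  rw [← h]
  refine Finset.sum_congr rfl fun k hk => ?_
  unfold binomProb
  ring

/-- A good step. -/
def goodStep (n : ℕ) (p a : ℝ) (s s' : ℤ) : Prop :=
  |(s' : ℝ) / n - gDrift p ((s : ℝ) / n)| ≤ a * ((s : ℝ) / n)

open scoped Classical in
lemma good_prob (n : ℕ) (hn : 0 < n) (p : ℝ) (hp0 : 0 < p) (hp : p < 1 / 3) (s : ℤ)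
    (hs0 : 0 ≤ s) (hs : |s| ≤ (n : ℤ)) (a : ℝ) (ha : 0 < a) (ha1 : a ≤ 1) :
    1 - 2 * Real.exp (-(a ^ 2 * ((s : ℝ) / n) ^ 2 * n / 4)) ≤
      ∑ k ∈ Finset.range (n + 1),
        if goodStep n p a s (2 * (k : ℤ) - (n : ℤ)) then binomProb n p s k else 0 := by
  have hn' : (0 : ℝ) < n := by positivity
  have hx1 : (s : ℝ) / n ≤ 1 := by
    rw [div_le_one hn']
    exact_mod_cast (le_abs_self s).trans hs
  have hx0 : 0 ≤ (s : ℝ) / n := div_nonneg (by exact_mod_cast hs0) hn'.le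
  set x : ℝ := (s : ℝ) / n with hx
  have hl0 : 0 ≤ a * x := by positivity
  have hl1 : a * x ≤ 1 := by nlinarith
  have m1 := binom_mgf n hn p hp0 hp s hs (a * x) (by rw [abs_of_nonneg hl0]; exact hl1)
  have m2 := binom_mgf n hn p hp0 hp s hs (-(a * x)) (by rw [abs_neg, abs_of_nonneg hl0]; exact hl1)
  have key : ∀ k ∈ Finset.range (n + 1), binomProb n p s k ≤
      (if goodStep n p a s (2 * (k : ℤ) - (n : ℤ)) then binomProb n p s k else 0) +
      Real.exp (-(a ^ 2 * x ^ 2 * n / 2)) *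
      (binomProb n p s k * Real.exp (a * x * (k - n * qStep n p s)) +
       binomProb n p s k * Real.exp (-(a * x) * (k - n * qStep n p s))) := by
    intro k hk
    have hb := binomProb_nonneg n hn p hp0 hp s hs k
    split_ifs with hg
    · have : 0 ≤ Real.exp (-(a ^ 2 * x ^ 2 * n / 2)) *
        (binomProb n p s k * Real.exp (a * x * (k - n * qStep n p s)) +
         binomProb n p s k * Real.exp (-(a * x) * (k - n * qStep n p s))) := by positivity
      linarith
    · unfold goodStep at hg
      rw [← hx, hx, ← qStep_eq n hn, ← hx, not_le] at hg
      have e : ((2 * (k : ℤ) - (n : ℤ) : ℤ) : ℝ) / n - (2 * qStep n p s - 1)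
          = 2 * (k - n * qStep n p s) / n := by
        push_cast
        field_simp
        ring
      rw [e] at hg
      rw [zero_add, ← mul_add, mul_left_comm]
      refine le_mul_of_one_le_right hb ?_
      rw [mul_add, ← Real.exp_add, ← Real.exp_add]
      set d : ℝ := k - n * qStep n p s
      rcases lt_abs.mp hg with h | h
      · have h' : a * x * n < 2 * d := by rwa [lt_div_iff₀ hn'] at h
        have : (1 : ℝ) ≤ Real.exp (-(a ^ 2 * x ^ 2 * n / 2) + a * x * d) :=
          Real.one_le_exp (by nlinarith)
        have := Real.exp_pos (-(a ^ 2 * x ^ 2 * n / 2) + -(a * x) * d)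
        linarith
      · have h' : a * x * n < -(2 * d) := by
          rw [← neg_div, lt_div_iff₀ hn'] at h
          exact h
        have : (1 : ℝ) ≤ Real.exp (-(a ^ 2 * x ^ 2 * n / 2) + -(a * x) * d) :=
          Real.one_le_exp (by nlinarith)
        have := Real.exp_pos (-(a ^ 2 * x ^ 2 * n / 2) + (a * x) * d)
        linarith
  have hsum := Finset.sum_le_sum key
  rw [binom_sum, Finset.sum_add_distrib, ← Finset.mul_sum, Finset.sum_add_distrib] at hsum
  have hE := Real.exp_pos (-(a ^ 2 * x ^ 2 * n / 2))
  have hm : Real.exp (-(a ^ 2 * x ^ 2 * n / 2)) * Real.exp (n * (a * x) ^ 2 / 4) =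
      Real.exp (-(a ^ 2 * x ^ 2 * n / 4)) := by
    rw [← Real.exp_add]
    ring_nf
  rw [neg_sq] at m2
  have h6 := mul_le_mul_of_nonneg_left (add_le_add m1 m2) hE.le
  rw [mul_add _ (Real.exp (n * (a * x) ^ 2 / 4)), hm] at h6
  linarith

lemma biasAt_congr (n : ℕ) (s0 : ℤ) (f g : ℕ → Fin (n + 1)) (t : ℕ)
    (h : ∀ i < t, f i = g i) : biasAt n s0 f t = biasAt n s0 g t := by
  cases t with
  | zero => rfl
  | succ t => simp [biasAt, h t (Nat.lt_succ_self t)]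

lemma trajP_congr (n : ℕ) (p : ℝ) (s0 : ℤ) (f g : ℕ → Fin (n + 1)) (t : ℕ)
    (h : ∀ i < t, f i = g i) : trajP n p s0 f t = trajP n p s0 g t := by
  induction t with
  | zero => rfl
  | succ t ih =>
    have h' : ∀ i < t, f i = g i := fun i hi => h i (by omega)
    simp only [trajP]
    rw [ih h', biasAt_congr n s0 f g t h', h t (Nat.lt_succ_self t)]

lemma biasAt_abs (n : ℕ) (s0 : ℤ) (f : ℕ → Fin (n + 1)) (hs : |s0| ≤ (n : ℤ)) (t : ℕ) :
    |biasAt n s0 f t| ≤ (n : ℤ) := by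
  cases t with
  | zero => exact hs
  | succ t =>
    have := (f t).isLt
    simp only [biasAt]
    rw [abs_le]
    constructor <;> omega

lemma trajP_nonneg (n : ℕ) (hn : 0 < n) (p : ℝ) (hp0 : 0 < p) (hp : p < 1 / 3) (s0 : ℤ)
    (f : ℕ → Fin (n + 1)) (hs : |s0| ≤ (n : ℤ)) (t : ℕ) : 0 ≤ trajP n p s0 f t := by
  induction t with
  | zero => simp [trajP]
  | succ t ih =>
    exact mul_nonneg ih (binomProb_nonneg n hn p hp0 hp _ (biasAt_abs n s0 f hs t) _)

lemma extend_snoc_lt (n T : ℕ) (k : Fin (n + 1)) (w : Fin T → Fin (n + 1)) (i : ℕ) (hi : i < T) :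
    extendPath n (T + 1) (Fin.snoc (α := fun _ => Fin (n + 1)) w k) i = extendPath n T w i := by
  simp [extendPath, hi, Fin.snoc, Nat.lt_succ_of_lt hi]

lemma extend_snoc_eq (n T : ℕ) (k : Fin (n + 1)) (w : Fin T → Fin (n + 1)) :
    extendPath n (T + 1) (Fin.snoc (α := fun _ => Fin (n + 1)) w k) T = k := by
  simp [extendPath, Fin.snoc]

open scoped Classical in
lemma W_lower (n : ℕ) (hn : 0 < n) (p : ℝ) (hp0 : 0 < p) (hp : p < 1 / 3) (s0 : ℤ)
    (hs : |s0| ≤ (n : ℤ)) (err : ℝ) (herr : err ≤ 1) (good : ℤ → ℤ → Prop)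
    (T : ℕ)
    (hprob : ∀ (σ : ℕ → ℤ), σ 0 = s0 → (∀ t, |σ t| ≤ (n : ℤ)) → ∀ T,
      (∀ t < T, good (σ t) (σ (t + 1))) → 1 - err ≤ ∑ k ∈ Finset.range (n + 1),
        if good (σ T) (2 * (k : ℤ) - (n : ℤ)) then binomProb n p (σ T) k else 0) :
    (1 - err) ^ T ≤ trajProb n p s0 T (fun σ => ∀ t < T, good (σ t) (σ (t + 1))) := by
  induction T with
  | zero => simp [trajProb, trajP]
  | succ T ih =>
    rw [pow_succ]
    refine (mul_le_mul_of_nonneg_right ih (by linarith)).trans ?_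
    unfold trajProb
    rw [← (Fin.snocEquiv (fun _ : Fin (T + 1) => Fin (n + 1))).sum_comp, Fintype.sum_prod_type_right,
      Finset.sum_mul]
    refine Finset.sum_le_sum fun w _ => ?_
    have hext : ∀ k : Fin (n + 1), ∀ t ≤ T, biasAt n s0 (extendPath n (T + 1)
        (Fin.snoc (α := fun _ => Fin (n + 1)) w k)) t = biasAt n s0 (extendPath n T w) t :=
      fun k t ht => biasAt_congr _ _ _ _ _ fun i hi => extend_snoc_lt n T k w i (by omega)
    have hlast : ∀ k : Fin (n + 1), biasAt n s0 (extendPath n (T + 1)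
        (Fin.snoc (α := fun _ => Fin (n + 1)) w k)) (T + 1) = 2 * ((k : ℕ) : ℤ) - n := by
      intro k
      simp only [biasAt, extend_snoc_eq]
    have htr : ∀ k : Fin (n + 1), trajP n p s0 (extendPath n (T + 1)
        (Fin.snoc (α := fun _ => Fin (n + 1)) w k)) (T + 1) =
        trajP n p s0 (extendPath n T w) T *
          binomProb n p (biasAt n s0 (extendPath n T w) T) k := by
      intro k
      simp only [trajP, extend_snoc_eq, hext k T le_rfl]
      rw [trajP_congr n p s0 _ (extendPath n T w) T fun i hi => extend_snoc_lt n T k w i hi]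
    have hev : ∀ k : Fin (n + 1), (∀ t < T + 1, good
        (biasAt n s0 (extendPath n (T + 1) (Fin.snoc (α := fun _ => Fin (n + 1)) w k)) t)
        (biasAt n s0 (extendPath n (T + 1) (Fin.snoc (α := fun _ => Fin (n + 1)) w k)) (t + 1))) ↔
        ((∀ t < T, good (biasAt n s0 (extendPath n T w) t) (biasAt n s0 (extendPath n T w) (t + 1)))
         ∧ good (biasAt n s0 (extendPath n T w) T) (2 * ((k : ℕ) : ℤ) - n)) := by
      intro k
      constructor
      · intro h
        refine ⟨fun t ht => ?_, ?_⟩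
        · have := h t (by omega)
          rwa [hext k t (by omega), hext k (t + 1) (by omega)] at this
        · have := h T (by omega)
          rwa [hext k T le_rfl, hlast] at this
      · rintro ⟨h1, h2⟩ t ht
        rcases Nat.lt_succ_iff_lt_or_eq.mp ht with h | rfl
        · rw [hext k t (by omega), hext k (t + 1) (by omega)]
          exact h1 t h
        · rw [hext k t le_rfl, hlast]
          exact h2
    have hsn : ∀ k : Fin (n + 1), (Fin.snocEquiv (fun _ : Fin (T + 1) => Fin (n + 1))) (k, w) =
        Fin.snoc (α := fun _ => Fin (n + 1)) w k := fun k => rfl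
    simp only [hsn, hev, htr]
    by_cases hG : ∀ t < T, good (biasAt n s0 (extendPath n T w) t)
        (biasAt n s0 (extendPath n T w) (t + 1))
    · rw [if_pos hG]
      have h1 := hprob _ rfl (biasAt_abs n s0 (extendPath n T w) hs) T hG
      have h2 := mul_le_mul_of_nonneg_left h1
        (trajP_nonneg n hn p hp0 hp s0 (extendPath n T w) hs T)
      refine h2.trans (le_of_eq ?_)
      rw [Finset.sum_range, Finset.mul_sum]
      refine Finset.sum_congr rfl fun k _ => ?_
      by_cases hk : good (biasAt n s0 (extendPath n T w) T) (2 * ((k : ℕ) : ℤ) - n)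
      · rw [if_pos hk, if_pos ⟨hG, hk⟩]
      · rw [if_neg hk, if_neg (fun h => hk h.2), mul_zero]
    · rw [if_neg hG, zero_mul]
      refine Finset.sum_nonneg fun k _ => ?_
      rw [if_neg (fun h => hG h.1)]

lemma trajProb_mono (n : ℕ) (hn : 0 < n) (p : ℝ) (hp0 : 0 < p) (hp : p < 1 / 3) (s0 : ℤ)
    (hs : |s0| ≤ (n : ℤ)) (T : ℕ) (E F : (ℕ → ℤ) → Prop)
    (h : ∀ σ : ℕ → ℤ, σ 0 = s0 → (∀ t, |σ t| ≤ (n : ℤ)) → E σ → F σ) :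
    trajProb n p s0 T E ≤ trajProb n p s0 T F := by
  classical
  unfold trajProb
  refine Finset.sum_le_sum fun w _ => ?_
  have h0 := trajP_nonneg n hn p hp0 hp s0 (extendPath n T w) hs T
  by_cases hE : E (biasAt n s0 (extendPath n T w))
  · rw [if_pos hE, if_pos (h _ rfl (biasAt_abs n s0 _ hs) hE)]
  · rw [if_neg hE]
    split_ifs
    · exact h0
    · exact le_rfl

/-- Deterministic one-step facts. -/
lemma det_step (k e ε a x x' : ℝ) (hk0 : 0 < k) (hk1 : k ≤ 1 / 2) (he0 : 0 < e) (he1 : e ≤ 1)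
    (hε0 : 0 < ε) (hε1 : ε < 1 / 3) (ha : a = k * e ^ 2 * ε / 2) (hx0 : 0 < x) (hx1 : x ≤ 1)
    (h : |x' - (x + k * x * (e ^ 2 - x ^ 2))| ≤ a * x) :
    (x < (1 - ε) * e → (1 + a) * x ≤ x' ∧ x' ≤ (1 + ε) * e) ∧
    ((1 - ε) * e ≤ x → x ≤ (1 + ε) * e → (1 - ε) * e ≤ x' ∧ x' ≤ (1 + ε) * e) ∧
    ((1 + ε) * e < x → (1 - ε) * e ≤ x' ∧ (1 + a) * x' ≤ x) := by
  obtain ⟨h1, h2⟩ := abs_le.mp h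
  have hke : k * e ^ 2 ≤ e / 2 := by
    have : k * e ^ 2 ≤ 1 / 2 * e ^ 2 := by gcongr
    nlinarith
  have hke0 : 0 < k * e ^ 2 := by positivity
  have ha0 : 0 < a := by rw [ha]; positivity
  have hae : a ≤ ε * e / 4 := by rw [ha]; nlinarith
  have ha1 : a ≤ 1 / 12 := by nlinarith
  have hD : 0 ≤ 1 - k * x * (e + x) := by
    have : k * (x * (e + x)) ≤ 1 / 2 * (1 * 2) := by
      gcongr
      linarith
    nlinarith
  refine ⟨fun hl => ⟨?_, ?_⟩, fun hl hu => ?_, fun hu => ⟨?_, ?_⟩⟩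
  · have : x ^ 2 ≤ ((1 - ε) * e) ^ 2 := by gcongr
    have h3 : ε * e ^ 2 ≤ e ^ 2 - x ^ 2 := by
      nlinarith [mul_nonneg (mul_nonneg hε0.le (by linarith : 0 ≤ 1 - ε)) (sq_nonneg e)]
    have h4 : k * x * (ε * e ^ 2) ≤ k * x * (e ^ 2 - x ^ 2) := by gcongr
    have : k * x * (ε * e ^ 2) = 2 * a * x := by rw [ha]; ring
    linarith
  · have hxe : x ≤ e := by nlinarith
    have : 0 ≤ (e - x) * (1 - k * x * (e + x)) := mul_nonneg (by linarith) hD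
    have : a * x ≤ ε * e := by nlinarith
    nlinarith
  · have h23 : 2 / 3 * e ≤ x := by nlinarith
    have h3 : e ^ 2 ≤ x * (e + x) := by nlinarith
    have h4 : k * e ^ 2 ≤ k * (x * (e + x)) := by gcongr
    have hab : |x - e| ≤ ε * e := by rw [abs_le]; constructor <;> linarith
    have h5 : |(x - e) * (1 - k * x * (e + x))| ≤ ε * e * (1 - k * e ^ 2) := by
      rw [abs_mul, abs_of_nonneg hD]
      exact mul_le_mul hab (by linarith) hD (by positivity)
    obtain ⟨h6, h7⟩ := abs_le.mp h5
    have h8 : a * x ≤ ε * e * (k * e ^ 2) := by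
      have h9 : a * x ≤ a * (2 * e) := by gcongr; nlinarith
      have : a * (2 * e) = ε * e * (k * e ^ 2) := by rw [ha]; ring
      linarith
    constructor <;> nlinarith
  · have : 0 ≤ (x - e) * (1 - k * x * (e + x)) := mul_nonneg (by nlinarith) hD
    have : a * x ≤ ε * e := by nlinarith
    nlinarith
  · have : ((1 + ε) * e) ^ 2 ≤ x ^ 2 := by gcongr
    have h3 : 2 * ε * e ^ 2 ≤ x ^ 2 - e ^ 2 := by
      nlinarith [mul_nonneg (sq_nonneg ε) (sq_nonneg e)]
    have h4 : k * x * (2 * ε * e ^ 2) ≤ k * x * (x ^ 2 - e ^ 2) := by gcongr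
    have : k * x * (2 * ε * e ^ 2) = 4 * a * x := by rw [ha]; ring
    have h5 : x' ≤ x * (1 - 3 * a) := by linarith
    have h6 : (1 + a) * x' ≤ (1 + a) * (x * (1 - 3 * a)) := by gcongr
    nlinarith [mul_pos ha0 hx0, mul_pos (mul_pos ha0 ha0) hx0]

lemma det_inv (k e ε a m : ℝ) (hk0 : 0 < k) (hk1 : k ≤ 1 / 2) (he0 : 0 < e) (he1 : e ≤ 1)
    (hε0 : 0 < ε) (hε1 : ε < 1 / 3) (ha : a = k * e ^ 2 * ε / 2) (x : ℕ → ℝ)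
    (hx1 : ∀ t, x t ≤ 1) (hm0 : 0 < m) (hm : m ≤ (1 - ε) * e) (hx0 : m ≤ x 0) (T : ℕ)
    (h : ∀ t < T, |x (t + 1) - (x t + k * x t * (e ^ 2 - x t ^ 2))| ≤ a * x t) :
    ∀ t ≤ T, m ≤ x t := by
  intro t
  induction t with
  | zero => intro _; exact hx0
  | succ t ih =>
    intro ht
    have h0 := ih (by omega)
    obtain ⟨A, B, D⟩ := det_step k e ε a (x t) (x (t + 1)) hk0 hk1 he0 he1 hε0 hε1 ha
      (by linarith) (hx1 t) (h t (by omega))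
    have ha0 : 0 < a := by rw [ha]; positivity
    by_cases c1 : x t < (1 - ε) * e
    · nlinarith [(A c1).1]
    · by_cases c2 : x t ≤ (1 + ε) * e
      · linarith [(B (by linarith) c2).1]
      · linarith [(D (by linarith)).1]

lemma det_main (k e ε a m : ℝ) (hk0 : 0 < k) (hk1 : k ≤ 1 / 2) (he0 : 0 < e) (he1 : e ≤ 1)
    (hε0 : 0 < ε) (hε1 : ε < 1 / 3) (ha : a = k * e ^ 2 * ε / 2) (x : ℕ → ℝ)
    (hx1 : ∀ t, x t ≤ 1) (hm0 : 0 < m) (hm : m ≤ (1 - ε) * e) (hx0 : m ≤ x 0) (T T0 : ℕ)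
    (hT : T0 ≤ T) (hT0 : 1 < (1 + a) ^ T0 * m)
    (h : ∀ t < T, |x (t + 1) - (x t + k * x t * (e ^ 2 - x t ^ 2))| ≤ a * x t) :
    ∃ τ ≤ T0, ∀ t, τ ≤ t → t ≤ T → (1 - ε) * e ≤ x t ∧ x t ≤ (1 + ε) * e := by
  have hinv := det_inv k e ε a m hk0 hk1 he0 he1 hε0 hε1 ha x hx1 hm0 hm hx0 T h
  have ha0 : 0 < a := by rw [ha]; positivity
  have hstep := fun t (ht : t < T) => det_step k e ε a (x t) (x (t + 1)) hk0 hk1 he0 he1 hε0 hε1 ha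
      (by linarith [hinv t ht.le]) (hx1 t) (h t ht)
  have hex : ∃ τ ≤ T0, (1 - ε) * e ≤ x τ ∧ x τ ≤ (1 + ε) * e := by
    by_contra hno
    push Not at hno
    by_cases c0 : x 0 < (1 - ε) * e
    · have : ∀ t ≤ T0, x t < (1 - ε) * e ∧ (1 + a) ^ t * m ≤ x t := by
        intro t
        induction t with
        | zero => intro _; simpa using ⟨c0, hx0⟩
        | succ t ih =>
          intro ht
          obtain ⟨i1, i2⟩ := ih (by omega)
          obtain ⟨A, -, -⟩ := hstep t (by omega)
          obtain ⟨A1, A2⟩ := A i1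
          constructor
          · by_contra hc
            exact absurd (hno (t + 1) ht (not_lt.mp hc)) (not_lt.mpr A2)
          · rw [pow_succ]
            nlinarith
      have := (this T0 le_rfl).2
      linarith [hx1 T0]
    · have : ∀ t ≤ T0, (1 + ε) * e < x t ∧ (1 + a) ^ t * x t ≤ 1 := by
        intro t
        induction t with
        | zero => intro _; simpa using ⟨hno 0 (by omega) (by linarith), hx1 0⟩
        | succ t ih =>
          intro ht
          obtain ⟨i1, i2⟩ := ih (by omega)
          obtain ⟨-, -, D⟩ := hstep t (by omega)
          obtain ⟨D1, D2⟩ := D i1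
          refine ⟨hno (t + 1) ht D1, ?_⟩
          rw [pow_succ, mul_assoc]
          exact (mul_le_mul_of_nonneg_left D2 (by positivity)).trans i2
      have h1 := (this T0 le_rfl).2
      have h2 : (1 + a) ^ T0 * m ≤ (1 + a) ^ T0 * x T0 := by
        gcongr
        exact hinv T0 hT
      linarith
  obtain ⟨τ, hτ, hin⟩ := hex
  refine ⟨τ, hτ, fun t => ?_⟩
  induction t with
  | zero =>
    intro h1 _
    have : τ = 0 := by omega
    rwa [this] at hin
  | succ t ih =>
    intro h1 h2
    rcases Nat.lt_or_ge t τ with h3 | h3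
    · have : t + 1 = τ := by omega
      rwa [this]
    · obtain ⟨i1, i2⟩ := ih h3 (by omega)
      exact (hstep t (by omega)).2.1 i1 i2

lemma asym_T (C η : ℝ) (hC : 0 < C) (hη : 0 < η) : ∀ᶠ n : ℕ in Filter.atTop,
    ((⌈C * Real.log n⌉₊ + ⌈(n : ℝ) ^ (η / 4)⌉₊ : ℕ) : ℝ) * (2 * (n : ℝ) ^ (-η)) ≤
      (n : ℝ) ^ (-(η / 2)) ∧ 2 * (n : ℝ) ^ (-η) ≤ 1 := by
  have hlog := ((isLittleO_log_rpow_atTop (by positivity : 0 < η / 4)).comp_tendsto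
    tendsto_natCast_atTop_atTop).bound (inv_pos.mpr hC)
  have hz := ((tendsto_rpow_atTop (by positivity : 0 < η / 4)).comp
    (tendsto_natCast_atTop_atTop (R := ℝ))).eventually_ge_atTop 8
  filter_upwards [hlog, hz, Filter.eventually_ge_atTop 1] with n h1 h2 hn
  simp only [Function.comp] at h1 h2
  have hn' : (1 : ℝ) ≤ n := by exact_mod_cast hn
  have hn0 : (0 : ℝ) < n := by linarith
  have hl0 : 0 ≤ Real.log n := Real.log_nonneg hn'
  have e1 : (n : ℝ) ^ (-η) * ((n : ℝ) ^ (η / 4) * (n : ℝ) ^ (η / 4)) = (n : ℝ) ^ (-(η / 2)) := by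
    rw [← Real.rpow_add hn0, ← Real.rpow_add hn0]
    ring_nf
  have e2 : (n : ℝ) ^ (-(η / 2)) * ((n : ℝ) ^ (η / 4) * (n : ℝ) ^ (η / 4)) = 1 := by
    rw [← Real.rpow_add hn0, ← Real.rpow_add hn0]
    ring_nf
    simp
  have hu : 0 < (n : ℝ) ^ (-η) := Real.rpow_pos_of_pos hn0 _
  have hv : 0 < (n : ℝ) ^ (-(η / 2)) := Real.rpow_pos_of_pos hn0 _
  set z := (n : ℝ) ^ (η / 4)
  rw [Real.norm_of_nonneg hl0, Real.norm_of_nonneg (by linarith), inv_mul_eq_div,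
    le_div_iff₀ hC] at h1
  have c1 := Nat.ceil_lt_add_one (by positivity : 0 ≤ C * Real.log n)
  have c2 := Nat.ceil_lt_add_one (by linarith : 0 ≤ z)
  have hzz : 64 ≤ z * z := by nlinarith
  constructor
  · have hT : ((⌈C * Real.log n⌉₊ + ⌈z⌉₊ : ℕ) : ℝ) ≤ 4 * z := by
      push_cast
      linarith
    calc _ ≤ 4 * z * (2 * (n : ℝ) ^ (-η)) := by gcongr
      _ = (n : ℝ) ^ (-η) * (8 * z) := by ring
      _ ≤ (n : ℝ) ^ (-η) * (z * z) := by gcongr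
      _ = _ := e1
  · have : (n : ℝ) ^ (-(η / 2)) ≤ 1 := by nlinarith
    nlinarith

lemma asym_S (γ d ℓ : ℝ) (hγ : 0 < γ) (hd : 0 < d) : ∀ᶠ n : ℕ in Filter.atTop,
    1 ≤ γ * Real.sqrt (n * Real.log n) ∧ γ * Real.sqrt (n * Real.log n) ≤ d * n ∧
      ℓ < Real.log n ∧ 2 ≤ n := by
  have h1 := (Real.isLittleO_log_id_atTop.comp_tendsto
    (tendsto_natCast_atTop_atTop (R := ℝ))).bound (by positivity : 0 < (d / γ) ^ 2)
  have h2 := (Real.tendsto_log_atTop.comp (tendsto_natCast_atTop_atTop (R := ℝ)))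
  have h3 := (tendsto_natCast_atTop_atTop (R := ℝ)).eventually_ge_atTop (1 / γ ^ 2)
  filter_upwards [h1, h2.eventually_ge_atTop 1, h2.eventually_gt_atTop ℓ, h3,
    Filter.eventually_ge_atTop 2] with n h1 h2 h2' h3 hn
  simp only [Function.comp, id] at h1 h2 h2'
  have hn0 : (0 : ℝ) < n := by positivity
  rw [Real.norm_of_nonneg (by linarith), Real.norm_of_nonneg hn0.le] at h1
  refine ⟨?_, ?_, h2', hn⟩
  · have : 1 / γ ≤ Real.sqrt (n * Real.log n) := by
      apply Real.le_sqrt_of_sq_le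
      rw [div_pow, one_pow]
      nlinarith
    rw [div_le_iff₀ hγ] at this
    linarith
  · have : Real.sqrt (n * Real.log n) ≤ d / γ * n := by
      apply Real.sqrt_le_iff.mpr ⟨by positivity, ?_⟩
      rw [mul_pow]
      nlinarith
    calc _ ≤ γ * (d / γ * n) := by gcongr
      _ = d * n := by field_simp

/-- Victory of the majority. Let `p < 1/3`, `ε ∈ (0, 1/3)` with
`ε² ≤ (1−3p)/2`, and `γ > 0`. Then w.h.p. (probability at least `1 − n^{−β}` for some
constant `β > 0`), for every sufficiently large `n` and every starting bias
`s0 ≥ γ√(n log n)`: (i) there is a time `τ₁ ≤ C log n` with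
`(1−ε)s_eq ≤ s_{τ₁} ≤ (1+ε)s_eq`, and (ii) there is a constant `c > 0` such that
for all `k ≤ n^c`, `(1−ε)s_eq ≤ s_{τ₁+k} ≤ (1+ε)s_eq`. -/
theorem victory_of_the_majority
    (p : ℝ) (hp0 : 0 < p) (hp : p < 1 / 3)
    (ε : ℝ) (hε0 : 0 < ε) (hε1 : ε < 1 / 3) (hε2 : ε ^ 2 ≤ (1 - 3 * p) / 2)
    (γ : ℝ) (hγ : 0 < γ) :
    ∃ C c β : ℝ, 0 < C ∧ 0 < c ∧ 0 < β ∧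
      ∃ N : ℕ, ∀ n : ℕ, N ≤ n → ∀ s0 : ℤ,
        γ * Real.sqrt (n * Real.log n) ≤ (s0 : ℝ) → |s0| ≤ (n : ℤ) →
        1 - (n : ℝ) ^ (-β) ≤
          trajProb n p s0 (⌈C * Real.log n⌉₊ + ⌈(n : ℝ) ^ c⌉₊)
            (fun σ => ∃ τ : ℕ, (τ : ℝ) ≤ C * Real.log n ∧
              ∀ k : ℕ, (k : ℝ) ≤ (n : ℝ) ^ c →
                (1 - ε) * sEq n p ≤ (σ (τ + k) : ℝ) ∧
                  (σ (τ + k) : ℝ) ≤ (1 + ε) * sEq n p) := by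
  set e : ℝ := Real.sqrt ((1 - 3 * p) / (1 - p)) / (1 - p) with he
  set k : ℝ := (1 - p) ^ 3 / 2 with hk
  set a : ℝ := k * e ^ 2 * ε / 2 with ha
  have hq : 0 < 1 - p := by linarith
  have hfrac : 0 < (1 - 3 * p) / (1 - p) := div_pos (by linarith) hq
  have he0 : 0 < e := div_pos (Real.sqrt_pos.mpr hfrac) hq
  have hesq : e ^ 2 * (1 - p) ^ 3 = 1 - 3 * p := by
    rw [he, div_pow, Real.sq_sqrt hfrac.le]
    field_simp
  have he1 : e ≤ 1 := by
    have h3 : 0 < (1 - p) ^ 3 := by positivity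
    have : e ^ 2 ≤ 1 := by
      by_contra hc
      nlinarith [sq_nonneg p]
    nlinarith
  have hk0 : 0 < k := by positivity
  have hk1 : k ≤ 1 / 2 := by
    have : (1 - p) ^ 3 ≤ 1 := pow_le_one₀ hq.le (by linarith)
    rw [hk]; linarith
  have hg : ∀ x, gDrift p x = x + k * x * (e ^ 2 - x ^ 2) := by
    intro x
    have : k * e ^ 2 = (1 - 3 * p) / 2 := by rw [hk]; linarith
    have h2 : x + k * x * (e ^ 2 - x ^ 2) = x + x * (k * e ^ 2) - k * x ^ 3 := by ring
    rw [h2, this, hk, gDrift]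
    ring
  have ha0 : 0 < a := by positivity
  have ha1 : a ≤ 1 := by
    have h1 : e ^ 2 ≤ 1 := by nlinarith
    have h2 : k * e ^ 2 ≤ 1 := by nlinarith [sq_nonneg e]
    have h3 : k * e ^ 2 * ε ≤ 1 := by nlinarith [mul_pos hk0 (pow_pos he0 2)]
    rw [ha]; linarith
  set ℓ : ℝ := Real.log (1 + a) with hℓ
  have hℓ0 : 0 < ℓ := Real.log_pos (by linarith)
  set η : ℝ := a ^ 2 * γ ^ 2 / 4 with hη
  have hη0 : 0 < η := by positivity
  have hL : 0 < (1 - ε) * e := mul_pos (by linarith) he0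
  refine ⟨2 / ℓ, η / 4, η / 2, by positivity, by positivity, by positivity, ?_⟩
  obtain ⟨N, hN⟩ := Filter.eventually_atTop.mp ((asym_T (2 / ℓ) η (by positivity) hη0).and
    (asym_S γ ((1 - ε) * e) ℓ hγ hL))
  refine ⟨N, fun n hn s0 hs0 hs => ?_⟩
  obtain ⟨⟨hT, herr⟩, hS1, hS2, hS3, hn2⟩ := hN n hn
  have hnpos : 0 < n := by omega
  have hn0 : (0 : ℝ) < n := by exact_mod_cast hnpos
  have hlog0 : 0 < Real.log n := hℓ0.trans hS3
  set m : ℝ := γ * Real.sqrt (n * Real.log n) / n with hm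
  have hm0 : 0 < m := div_pos (by linarith) hn0
  have hmL : m ≤ (1 - ε) * e := by rwa [hm, div_le_iff₀ hn0]
  have hmn : 1 / n ≤ m := by rw [hm]; gcongr
  have hm2 : m ^ 2 * n = γ ^ 2 * Real.log n := by
    rw [hm, div_pow, mul_pow, Real.sq_sqrt (by positivity)]
    field_simp
  set T : ℕ := ⌈2 / ℓ * Real.log n⌉₊ + ⌈(n : ℝ) ^ (η / 4)⌉₊ with hTdef
  set T0 : ℕ := ⌊2 / ℓ * Real.log n⌋₊ with hT0def
  have hT0T : T0 ≤ ⌈2 / ℓ * Real.log n⌉₊ := Nat.floor_le_ceil _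
  have hT0 : 1 < (1 + a) ^ T0 * m := by
    have h1 : 2 / ℓ * Real.log n < T0 + 1 := Nat.lt_floor_add_one _
    have h2 : Real.log n < T0 * ℓ := by
      have : 2 / ℓ * Real.log n * ℓ < (T0 + 1) * ℓ := by gcongr
      have h3 : 2 / ℓ * Real.log n * ℓ = 2 * Real.log n := by field_simp
      linarith
    have h3 : (n : ℝ) < (1 + a) ^ T0 := by
      rw [← Real.log_lt_log_iff hn0 (by positivity), Real.log_pow]
      exact h2
    calc (1 : ℝ) = n * (1 / n) := by field_simp
      _ < (1 + a) ^ T0 * (1 / n) := by gcongr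
      _ ≤ _ := by gcongr
  have hx1 : ∀ σ : ℕ → ℤ, (∀ t, |σ t| ≤ (n : ℤ)) → ∀ t, (σ t : ℝ) / n ≤ 1 := by
    intro σ h t
    rw [div_le_one hn0]
    exact_mod_cast (le_abs_self _).trans (h t)
  have hx0 : m ≤ (s0 : ℝ) / n := by rw [hm]; gcongr
  have hW := W_lower n hnpos p hp0 hp s0 hs (2 * (n : ℝ) ^ (-η)) herr (goodStep n p a) T (by
    intro σ h0 habs R hgood
    have hinv := det_inv k e ε a m hk0 hk1 he0 he1 hε0 hε1 ha (fun t => (σ t : ℝ) / n)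
      (hx1 σ habs) hm0 hmL (by simpa [h0] using hx0) R
      (fun t ht => by have := hgood t ht; rwa [goodStep, hg] at this) R le_rfl
    have hpos : (0 : ℝ) ≤ σ R := by
      have : 0 < (σ R : ℝ) / n := by linarith
      rw [div_pos_iff_of_pos_right hn0] at this
      exact this.le
    refine le_trans ?_ (good_prob n hnpos p hp0 hp (σ R) (by exact_mod_cast hpos) (habs R) a ha0 ha1)
    have : Real.exp (-(a ^ 2 * ((σ R : ℝ) / n) ^ 2 * n / 4)) ≤ (n : ℝ) ^ (-η) := by
      rw [Real.rpow_def_of_pos hn0]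
      apply Real.exp_le_exp.mpr
      have h1 : m ^ 2 * n ≤ ((σ R : ℝ) / n) ^ 2 * n := by gcongr
      have h2 : a ^ 2 * (m ^ 2 * n) ≤ a ^ 2 * (((σ R : ℝ) / n) ^ 2 * n) := by gcongr
      rw [hm2] at h2
      rw [hη]
      linarith
    linarith)
  have hB := one_add_mul_le_pow (a := -(2 * (n : ℝ) ^ (-η))) (by linarith) T
  have hmono := trajProb_mono n hnpos p hp0 hp s0 hs T
    (fun σ => ∀ t < T, goodStep n p a (σ t) (σ (t + 1))) (fun σ => ∃ τ : ℕ, (τ : ℝ) ≤ 2 / ℓ * Real.log n ∧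
              ∀ k : ℕ, (k : ℝ) ≤ (n : ℝ) ^ (η / 4) →
                (1 - ε) * sEq n p ≤ (σ (τ + k) : ℝ) ∧
                  (σ (τ + k) : ℝ) ≤ (1 + ε) * sEq n p) (by
    intro σ h0 habs hgood
    obtain ⟨τ, hτ, hall⟩ := det_main k e ε a m hk0 hk1 he0 he1 hε0 hε1 ha (fun t => (σ t : ℝ) / n)
      (hx1 σ habs) hm0 hmL (by simpa [h0] using hx0) T T0 (by omega) hT0
      (fun t ht => by have := hgood t ht; rwa [goodStep, hg] at this)
    refine ⟨τ, ?_, fun j hj => ?_⟩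
    · calc (τ : ℝ) ≤ T0 := by exact_mod_cast hτ
        _ ≤ _ := Nat.floor_le (by positivity)
    · have hj' : j ≤ ⌈(n : ℝ) ^ (η / 4)⌉₊ := by
        exact_mod_cast hj.trans (Nat.le_ceil _)
      obtain ⟨b1, b2⟩ := hall (τ + j) (by omega) (by omega)
      have hse : sEq n p = e * n := by rw [sEq, he]; ring
      rw [le_div_iff₀ hn0] at b1
      rw [div_le_iff₀ hn0] at b2
      rw [hse, ← mul_assoc, ← mul_assoc]
      exact ⟨b1, b2⟩)
  rw [← sub_eq_add_neg] at hB
  refine le_trans ?_ ((hB.trans hW).trans hmono)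
  linarith
end

section
/- Let p < 1/3 and let k > 0 be any constant. For the 3-Majority dynamics with uniform noise probability p and all sufficiently large n, if s is a bias value with s_eq ≤ s ≤ n, then P( s_t ≥ (2/3)·s_eq | s_{t−1} = s ) ≥ 1 − 1/n^k. -/
/-- Chernoff-type bound for the lower tail of the one-step bias. -/
lemma chernoff_aux (n : ℕ) (p : ℝ) (s : ℤ) (T l : ℝ) (hl : 0 ≤ l)
    (h0 : 0 ≤ qStep n p s) (h1 : qStep n p s ≤ 1) :
    1 - Real.exp (l * T) *
      (qStep n p s * Real.exp (-l) + (1 - qStep n p s) * Real.exp l) ^ n ≤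
      stepProb n p s (fun x => T ≤ (x : ℝ)) := by
  classical
  have hsum : ∑ k ∈ Finset.range (n + 1), binomProb n p s k = 1 := by
    have h := add_pow (qStep n p s) (1 - qStep n p s) n
    rw [add_sub_cancel, one_pow] at h
    rw [h]
    exact Finset.sum_congr rfl fun k _ => by unfold binomProb; ring
  have hmgf : Real.exp (l * T) *
      (qStep n p s * Real.exp (-l) + (1 - qStep n p s) * Real.exp l) ^ n =
      ∑ k ∈ Finset.range (n + 1),
        binomProb n p s k * Real.exp (l * (T - (2 * (k : ℝ) - n))) := by
    rw [add_pow, Finset.mul_sum]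
    refine Finset.sum_congr rfl fun k hk => ?_
    have hkn : k ≤ n := Nat.lt_succ_iff.mp (Finset.mem_range.mp hk)
    have : Real.exp (l * (T - (2 * (k : ℝ) - n))) =
        Real.exp (l * T) * Real.exp (-l) ^ k * Real.exp l ^ (n - k) := by
      rw [← Real.exp_nat_mul, ← Real.exp_nat_mul, ← Real.exp_add, ← Real.exp_add,
        Nat.cast_sub hkn]
      congr 1; ring
    rw [this]; unfold binomProb
    rw [mul_pow, mul_pow]; ring
  rw [hmgf, ← hsum, ← Finset.sum_sub_distrib]
  unfold stepProb
  refine Finset.sum_le_sum fun k _ => ?_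
  have hb : 0 ≤ binomProb n p s k := by
    unfold binomProb
    have : 0 ≤ 1 - qStep n p s := by linarith
    positivity
  split_ifs with h
  · have := mul_nonneg hb (Real.exp_pos (l * (T - (2 * (k : ℝ) - n)))).le
    linarith
  · push_cast at h
    have h2 : 1 ≤ Real.exp (l * (T - (2 * (k : ℝ) - n))) :=
      Real.one_le_exp (mul_nonneg hl (by linarith))
    nlinarith

/-- Let `p < 1/3` and `k > 0`. For all sufficiently large `n`, if
`s_eq ≤ s ≤ n`, then `P(s_t ≥ (2/3)s_eq | s_{t−1} = s) ≥ 1 − 1/n^k`. -/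
theorem bias_stays_above_two_thirds_eq
    (p : ℝ) (hp0 : 0 < p) (hp : p < 1 / 3) (k : ℝ) (hk : 0 < k) :
    ∃ N : ℕ, ∀ n : ℕ, N ≤ n → ∀ s : ℤ,
      sEq n p ≤ (s : ℝ) → s ≤ (n : ℤ) →
      1 - 1 / (n : ℝ) ^ k ≤
        stepProb n p s (fun x => 2 / 3 * sEq n p ≤ (x : ℝ)) := by
  have hp1 : 0 < 1 - p := by linarith
  obtain ⟨r, hr⟩ : ∃ r, r = Real.sqrt ((1 - 3 * p) / (1 - p)) := ⟨_, rfl⟩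
  have hpos : 0 < (1 - 3 * p) / (1 - p) := div_pos (by linarith) hp1
  have hr0 : 0 < r := hr ▸ Real.sqrt_pos.mpr hpos
  have hr2 : r ^ 2 * (1 - p) = 1 - 3 * p := by
    rw [hr, Real.sq_sqrt hpos.le]; field_simp
  have hr1 : r ≤ 1 := by
    by_contra h
    push Not at h
    have h2 : 1 < r ^ 2 := by nlinarith
    nlinarith [mul_lt_mul_of_pos_right h2 hp1]
  obtain ⟨e, he⟩ : ∃ e, e = r / (1 - p) := ⟨_, rfl⟩
  have her : e * (1 - p) = r := by rw [he]; field_simp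
  have he0 : 0 < e := he ▸ div_pos hr0 hp1
  have he2 : e ≤ 2 := by nlinarith
  have her3 : r * (3 - r ^ 2) / 2 = e := by
    have : r * (3 - r ^ 2) / 2 * (1 - p) = e * (1 - p) := by
      rw [her]; linear_combination (-r / 2) * hr2
    exact mul_right_cancel₀ hp1.ne' this
  have hlim := (tendsto_rpow_mul_exp_neg_mul_atTop_nhds_zero k (e ^ 2 / 36)
    (by positivity)).comp tendsto_natCast_atTop_atTop
  obtain ⟨N, hN⟩ := Filter.eventually_atTop.mp
    (hlim.eventually (gt_mem_nhds (zero_lt_one)))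
  refine ⟨N + 1, fun n hn s hs hsn => ?_⟩
  have hn0 : (0 : ℝ) < n := by exact_mod_cast (by omega : 0 < n)
  have hsE : sEq n p = e * n := by
    unfold sEq; rw [← hr, he]; ring
  rw [hsE] at hs ⊢
  have hsn' : (s : ℝ) ≤ n := by exact_mod_cast hsn
  obtain ⟨x, hx⟩ : ∃ x : ℝ, x = (s : ℝ) / n * (1 - p) := ⟨_, rfl⟩
  have hq : qStep n p s = 1 / 2 + x * (3 - x ^ 2) / 4 := by
    unfold qStep; rw [hx]; field_simp; ring
  have hxr : r ≤ x := by
    rw [hx, ← her]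
    exact mul_le_mul_of_nonneg_right ((le_div_iff₀ hn0).mpr hs) hp1.le
  have hx1 : x ≤ 1 := by
    have : (s : ℝ) / n ≤ 1 := (div_le_one hn0).mpr hsn'
    rw [hx]; nlinarith
  have hqe : 1 / 2 + e / 2 ≤ qStep n p s := by
    rw [hq, ← her3]
    have h3 : x ^ 2 + x * r + r ^ 2 ≤ 3 := by nlinarith
    nlinarith [mul_nonneg (sub_nonneg.mpr hxr) (sub_nonneg.mpr h3)]
  have hq1 : qStep n p s ≤ 1 := by
    rw [hq]
    nlinarith [mul_nonneg (sq_nonneg (x - 1)) (by linarith : 0 ≤ x + 2)]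
  have hch := chernoff_aux n p s (2 / 3 * (e * n)) (e / 6) (by positivity)
    (by linarith) hq1
  refine le_trans ?_ hch
  generalize qStep n p s = q at *
  have hl1 : |e / 6| ≤ 1 := by rw [abs_of_pos (by positivity)]; linarith
  have e1 := (abs_le.mp (Real.abs_exp_sub_one_sub_id_le hl1)).2
  have e2 := (abs_le.mp (Real.abs_exp_sub_one_sub_id_le (x := -(e / 6))
    (by rwa [abs_neg]))).2
  have hM : q * Real.exp (-(e / 6)) + (1 - q) * Real.exp (e / 6) ≤
      Real.exp (-(5 * e ^ 2 / 36)) := by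
    refine le_trans ?_ (Real.add_one_le_exp _)
    have a1 := mul_le_mul_of_nonneg_left e1 (by linarith : 0 ≤ 1 - q)
    have a2 := mul_le_mul_of_nonneg_left e2 (by linarith : 0 ≤ q)
    nlinarith [mul_le_mul_of_nonneg_left hqe he0.le]
  have hM0 : 0 ≤ q * Real.exp (-(e / 6)) + (1 - q) * Real.exp (e / 6) :=
    add_nonneg (mul_nonneg (by linarith) (Real.exp_pos _).le)
      (mul_nonneg (by linarith) (Real.exp_pos _).le)
  have hfin : Real.exp (e / 6 * (2 / 3 * (e * n))) *
      (q * Real.exp (-(e / 6)) + (1 - q) * Real.exp (e / 6)) ^ n ≤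
      Real.exp (-(e ^ 2 / 36) * n) := by
    calc _ ≤ Real.exp (e / 6 * (2 / 3 * (e * n))) * Real.exp (-(5 * e ^ 2 / 36)) ^ n := by
          gcongr
      _ = _ := by
          rw [← Real.exp_nat_mul, ← Real.exp_add]; congr 1; ring
  have hNn := hN n (by omega)
  simp only [Function.comp] at hNn
  have hnk : 0 < (n : ℝ) ^ k := Real.rpow_pos_of_pos hn0 k
  have : Real.exp (-(e ^ 2 / 36) * n) ≤ 1 / (n : ℝ) ^ k := by
    rw [le_div_iff₀ hnk]; linarith
  linarith
end

section
/- Let p < 1/3 and let k > 0 be any constant. For the 3-Majority dynamics with uniform noise probability p and all sufficiently large n, if s is a bias value with 0 ≤ s ≤ (2/3)·s_eq, then P( s_t ≤ s_eq | s_{t−1} = s ) ≥ 1 − 1/n^k. -/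
lemma chernoff_aux_s9 (n : ℕ) (q l T : ℝ) (hq0 : 0 ≤ q) (hq1 : q ≤ 1) (hl : 0 ≤ l)
    (P : ℕ → Prop) [DecidablePred P] (hP : ∀ k, P k ↔ 2 * (k : ℝ) - n ≤ T) :
    1 - Real.exp (-(l * T)) * (q * Real.exp l + (1 - q) * Real.exp (-l)) ^ n ≤
      ∑ k ∈ Finset.range (n + 1),
        if P k then (n.choose k : ℝ) * q ^ k * (1 - q) ^ (n - k) else 0 := by
  have h1 : (1 : ℝ) = ∑ k ∈ Finset.range (n + 1), (n.choose k : ℝ) * q ^ k * (1 - q) ^ (n - k) := by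
    have := add_pow q (1 - q) n
    rw [add_sub_cancel, one_pow] at this
    exact this.trans (Finset.sum_congr rfl fun k _ => by ring)
  have h2 : Real.exp (-(l * T)) * (q * Real.exp l + (1 - q) * Real.exp (-l)) ^ n =
      ∑ k ∈ Finset.range (n + 1), (n.choose k : ℝ) * q ^ k * (1 - q) ^ (n - k) *
        Real.exp (l * (2 * (k : ℝ) - n - T)) := by
    rw [add_pow, Finset.mul_sum]
    refine Finset.sum_congr rfl fun k hk => ?_
    have hkn : k ≤ n := by simpa [Nat.lt_succ_iff] using hk
    have e : Real.exp (l * (2 * (k : ℝ) - n - T)) =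
        Real.exp (-(l * T)) * (Real.exp l ^ k * Real.exp (-l) ^ (n - k)) := by
      rw [← Real.exp_nat_mul, ← Real.exp_nat_mul, ← Real.exp_add, ← Real.exp_add, Nat.cast_sub hkn]
      congr 1
      ring
    rw [e, mul_pow, mul_pow]
    ring
  rw [h2]
  nth_rewrite 1 [h1]
  rw [← Finset.sum_sub_distrib]
  refine Finset.sum_le_sum fun k _ => ?_
  have hB : 0 ≤ (n.choose k : ℝ) * q ^ k * (1 - q) ^ (n - k) := by
    have : 0 ≤ 1 - q := by linarith
    positivity
  split_ifs with h
  · have := mul_nonneg hB (Real.exp_pos (l * (2 * (k : ℝ) - n - T))).le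
    linarith
  · rw [hP, not_le] at h
    have : 1 ≤ Real.exp (l * (2 * (k : ℝ) - n - T)) :=
      Real.one_le_exp (mul_nonneg hl (by linarith))
    nlinarith

lemma mgf_aux (q l : ℝ) (hq0 : 0 ≤ q) (hq1 : q ≤ 1) (hl : 0 ≤ l) (hl1 : l ≤ 1) :
    q * Real.exp l + (1 - q) * Real.exp (-l) ≤ Real.exp (l * (2 * q - 1) + l ^ 2) := by
  have a1 := (abs_le.1 (Real.abs_exp_sub_one_sub_id_le (x := l) (by rwa [abs_of_nonneg hl]))).2
  have a2 := (abs_le.1 (Real.abs_exp_sub_one_sub_id_le (x := -l)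
    (by rwa [abs_neg, abs_of_nonneg hl]))).2
  have a3 := Real.add_one_le_exp (l * (2 * q - 1) + l ^ 2)
  have b1 := mul_le_mul_of_nonneg_left a1 hq0
  have b2 := mul_le_mul_of_nonneg_left a2 (sub_nonneg.2 hq1)
  linarith

/-- Let `p < 1/3` and `k > 0`. For all sufficiently large `n`, if
`0 ≤ s ≤ (2/3)s_eq`, then `P(s_t ≤ s_eq | s_{t−1} = s) ≥ 1 − 1/n^k`. -/
theorem bias_stays_below_eq
    (p : ℝ) (hp0 : 0 < p) (hp : p < 1 / 3) (k : ℝ) (hk : 0 < k) :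
    ∃ N : ℕ, ∀ n : ℕ, N ≤ n → ∀ s : ℤ,
      0 ≤ s → (s : ℝ) ≤ 2 / 3 * sEq n p →
      1 - 1 / (n : ℝ) ^ k ≤
        stepProb n p s (fun x => (x : ℝ) ≤ sEq n p) := by
  obtain ⟨z, hz⟩ : ∃ z, z = Real.sqrt ((1 - 3 * p) / (1 - p)) := ⟨_, rfl⟩
  have hp1 : 0 < 1 - p := by linarith
  have hz0 : 0 < z := by
    rw [hz]
    exact Real.sqrt_pos.2 (div_pos (by linarith) hp1)
  have hz1 : z ≤ 1 := by
    rw [hz, Real.sqrt_le_one, div_le_one hp1]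
    linarith
  obtain ⟨d, hd⟩ : ∃ d, d = 4 * z ^ 3 / 27 := ⟨_, rfl⟩
  have hd0 : 0 < d := by rw [hd]; positivity
  have hd1 : d ≤ 1 := by
    have : z ^ 3 ≤ 1 := pow_le_one₀ hz0.le hz1
    linarith
  have hc : 0 < d ^ 2 / 4 := by positivity
  have hlim := (tendsto_rpow_mul_exp_neg_mul_atTop_nhds_zero k (d ^ 2 / 4) hc).comp
    (tendsto_natCast_atTop_atTop (R := ℝ))
  obtain ⟨N, hN⟩ := Filter.eventually_atTop.1 (hlim.eventually (gt_mem_nhds one_pos))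
  refine ⟨N + 1, fun n hn s hs0 hs => ?_⟩
  have hnN := hN n (by omega)
  simp only [Function.comp] at hnN
  have hn0 : (0 : ℝ) < n := by exact_mod_cast (by omega : 0 < n)
  have hs0' : (0 : ℝ) ≤ s := by exact_mod_cast hs0
  obtain ⟨y, hy⟩ : ∃ y, y = (1 - p) * (s / n) := ⟨_, rfl⟩
  have hy0 : 0 ≤ y := by rw [hy]; positivity
  have hyz : y ≤ 2 / 3 * z := by
    rw [sEq, ← hz] at hs
    rw [hy, ← mul_div_assoc, div_le_iff₀ hn0]
    calc (1 - p) * s ≤ (1 - p) * (2 / 3 * (n / (1 - p) * z)) :=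
          mul_le_mul_of_nonneg_left hs hp1.le
      _ = 2 / 3 * z * n := by field_simp
  have hy1 : y ≤ 1 := by linarith
  have hq : qStep n p s = (2 + 3 * y - y ^ 3) / 4 := by
    have e1 : ((n : ℝ) + s) / (2 * n) * (1 - p) + p / 2 = (1 + y) / 2 := by
      rw [hy]; field_simp; ring
    have e2 : ((n : ℝ) - s) / (2 * n) * (1 - p) + p / 2 = (1 - y) / 2 := by
      rw [hy]; field_simp; ring
    rw [qStep, e1, e2]
    ring
  have hy3 : y ^ 3 ≤ y := by nlinarith [mul_nonneg hy0 (mul_nonneg (sub_nonneg.2 hy1) (by linarith : 0 ≤ 1 + y))]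
  have hq0 : 0 ≤ qStep n p s := by rw [hq]; linarith
  have hq1 : qStep n p s ≤ 1 := by
    rw [hq]
    nlinarith [mul_nonneg (sq_nonneg (1 - y)) (by linarith : 0 ≤ 2 + y)]
  have hmu : 2 * qStep n p s - 1 ≤ z - d := by
    rw [hq, hd]
    obtain ⟨w, hw⟩ : ∃ w, w = 2 / 3 * z := ⟨_, rfl⟩
    have hzw : z = 3 / 2 * w := by linarith
    have hw1 : w ≤ 1 := by linarith
    rw [← hw] at hyz
    rw [hzw]
    have : 0 ≤ (w - y) * (3 - (w ^ 2 + w * y + y ^ 2)) := by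
      apply mul_nonneg (by linarith)
      nlinarith
    nlinarith
  have hsz : n * z ≤ sEq n p := by
    rw [sEq, ← hz]
    apply mul_le_mul_of_nonneg_right _ hz0.le
    rw [le_div_iff₀ hp1]
    nlinarith
  have key := @chernoff_aux_s9 n (qStep n p s) (d / 2) (sEq n p) hq0 hq1 (by linarith)
    (fun k => ((2 * (k : ℤ) - (n : ℤ) : ℤ) : ℝ) ≤ sEq n p) (Classical.decPred _)
    (fun k => by push_cast; rfl)
  have hm := pow_le_pow_left₀ (by
    have : 0 ≤ 1 - qStep n p s := by linarith
    positivity) (mgf_aux (qStep n p s) (d / 2) hq0 hq1 (by linarith) (by linarith)) n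
  have hbound : Real.exp (-(d / 2 * sEq n p)) * (qStep n p s * Real.exp (d / 2) +
      (1 - qStep n p s) * Real.exp (-(d / 2))) ^ n ≤ 1 / (n : ℝ) ^ k := by
    calc _ ≤ Real.exp (-(d / 2 * sEq n p)) *
          Real.exp (d / 2 * (2 * qStep n p s - 1) + (d / 2) ^ 2) ^ n :=
          mul_le_mul_of_nonneg_left hm (Real.exp_pos _).le
      _ = Real.exp (-(d / 2 * sEq n p) + n * (d / 2 * (2 * qStep n p s - 1) + (d / 2) ^ 2)) := by
          rw [← Real.exp_nat_mul, ← Real.exp_add]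
      _ ≤ Real.exp (-(d ^ 2 / 4) * n) := by
          apply Real.exp_le_exp.2
          have i1 := mul_le_mul_of_nonneg_left hsz (by linarith : 0 ≤ d / 2)
          have i2 := mul_le_mul_of_nonneg_left hmu (by positivity : 0 ≤ (n : ℝ) * (d / 2))
          linarith
      _ ≤ 1 / (n : ℝ) ^ k := by
          rw [le_div_iff₀ (Real.rpow_pos_of_pos hn0 k), mul_comm]
          exact hnN.le
  refine le_trans (by linarith) (key.trans (le_of_eq ?_))
  unfold stepProb binomProb
  refine Finset.sum_congr rfl fun j _ => ?_
  congr
end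

section
/- Let p < 1/3, let γ > 0 be a constant, and let ε > 0 be a constant with ε < 1/3 and ε² < (1−3p)/2. For the 3-Majority dynamics with uniform noise probability p and all sufficiently large n, if s is a bias value with (ε/4)·s_eq ≤ |s_eq − s| ≤ s_eq/3, then P( |s_eq − s_t| ≤ |s_eq − s|·(1 − 3ε²/2⁵) | s_{t−1} = s ) ≥ 1 − n^{−γ²ε⁴p²/(2¹⁸·3²)}. -/
/-- Exponential-moment identity and bound for the binomial distribution. -/
lemma binom_mgf_le (n : ℕ) (q t : ℝ) (hq0 : 0 ≤ q) (hq1 : q ≤ 1) (ht : |t| ≤ 1) :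
    ∑ k ∈ Finset.range (n + 1), (n.choose k : ℝ) * q ^ k * (1 - q) ^ (n - k) *
      Real.exp (t * ((k : ℝ) - n * q)) ≤ Real.exp (n * t ^ 2) := by
  have h1 : ∑ k ∈ Finset.range (n + 1), (n.choose k : ℝ) * q ^ k * (1 - q) ^ (n - k) *
      Real.exp (t * ((k : ℝ) - n * q))
      = (q * Real.exp t + (1 - q)) ^ n * Real.exp (-(t * (n * q))) := by
    rw [add_pow, Finset.sum_mul]
    refine Finset.sum_congr rfl fun k _ => ?_
    have : Real.exp (t * ((k : ℝ) - n * q)) = Real.exp t ^ k * Real.exp (-(t * (n * q))) := by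
      rw [← Real.exp_nat_mul, ← Real.exp_add]; congr 1; ring
    rw [this, mul_pow]; ring
  have h2 : q * Real.exp t + (1 - q) ≤ Real.exp (q * t + t ^ 2) := by
    have := (abs_le.1 (Real.abs_exp_sub_one_sub_id_le ht)).2
    have h3 := Real.add_one_le_exp (q * t + t ^ 2)
    nlinarith [sq_nonneg t]
  have h0 : 0 ≤ q * Real.exp t + (1 - q) := by
    have := Real.exp_pos t
    nlinarith [mul_nonneg hq0 this.le]
  rw [h1]
  calc (q * Real.exp t + (1 - q)) ^ n * Real.exp (-(t * (n * q)))
      ≤ Real.exp (q * t + t ^ 2) ^ n * Real.exp (-(t * (n * q))) := by gcongr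
    _ = Real.exp (n * t ^ 2) := by
      rw [← Real.exp_nat_mul, ← Real.exp_add]; congr 1; ring

open scoped Classical in
/-- Two-sided concentration for the binomial distribution. -/
lemma binom_conc (n : ℕ) (q m : ℝ) (hq0 : 0 ≤ q) (hq1 : q ≤ 1) (hm0 : 0 ≤ m) (hm : m ≤ 2)
    (A : ℕ → Prop) (hA : ∀ k : ℕ, |(k : ℝ) - n * q| ≤ m * n → A k) :
    1 - 2 * Real.exp (-(m ^ 2 / 4) * n) ≤
    ∑ k ∈ Finset.range (n + 1),
      if A k then (n.choose k : ℝ) * q ^ k * (1 - q) ^ (n - k) else 0 := by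
  set w : ℕ → ℝ := fun k => (n.choose k : ℝ) * q ^ k * (1 - q) ^ (n - k) with hw
  have hw0 : ∀ k, 0 ≤ w k := fun k => by
    have : 0 ≤ 1 - q := by linarith
    simp only [hw]; positivity
  have hsum : ∑ k ∈ Finset.range (n + 1), w k = 1 := by
    have := add_pow q (1 - q) n
    rw [add_sub_cancel, one_pow] at this
    rw [this]
    exact Finset.sum_congr rfl fun k _ => by simp only [hw]; ring
  have ht : |m / 2| ≤ 1 := by rw [abs_of_nonneg (by linarith)]; linarith
  have ht' : |-(m / 2)| ≤ 1 := by rwa [abs_neg]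
  have h1 := binom_mgf_le n q (m / 2) hq0 hq1 ht
  have h2 := binom_mgf_le n q (-(m / 2)) hq0 hq1 ht'
  have key : ∀ k ∈ Finset.range (n + 1), w k - (w k * Real.exp (m / 2 * ((k : ℝ) - n * q)) +
      w k * Real.exp (-(m / 2) * ((k : ℝ) - n * q))) * Real.exp (-(m / 2 * (m * n))) ≤
      if A k then w k else 0 := by
    intro k _
    have e1 := Real.exp_pos (m / 2 * ((k : ℝ) - n * q))
    have e2 := Real.exp_pos (-(m / 2) * ((k : ℝ) - n * q))
    have e3 := Real.exp_pos (-(m / 2 * (m * n)))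
    have hwk := hw0 k
    split_ifs with h
    · have : 0 ≤ (w k * Real.exp (m / 2 * ((k : ℝ) - n * q)) +
        w k * Real.exp (-(m / 2) * ((k : ℝ) - n * q))) * Real.exp (-(m / 2 * (m * n))) := by
        positivity
      linarith
    · have hk : m * n < |(k : ℝ) - n * q| := by
        by_contra hc
        exact h (hA k (not_lt.1 hc))
      have : 1 ≤ (Real.exp (m / 2 * ((k : ℝ) - n * q)) +
          Real.exp (-(m / 2) * ((k : ℝ) - n * q))) * Real.exp (-(m / 2 * (m * n))) := by
        rw [add_mul, ← Real.exp_add, ← Real.exp_add]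
        rcases lt_abs.1 hk with hk | hk
        · have : 1 ≤ Real.exp (m / 2 * ((k : ℝ) - n * q) + -(m / 2 * (m * n))) := by
            apply Real.one_le_exp; nlinarith
          have := Real.exp_pos (-(m / 2) * ((k : ℝ) - n * q) + -(m / 2 * (m * n)))
          linarith
        · have : 1 ≤ Real.exp (-(m / 2) * ((k : ℝ) - n * q) + -(m / 2 * (m * n))) := by
            apply Real.one_le_exp; nlinarith
          have := Real.exp_pos (m / 2 * ((k : ℝ) - n * q) + -(m / 2 * (m * n)))
          linarith
      nlinarith [mul_le_mul_of_nonneg_left this hwk]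
  have h3 := Finset.sum_le_sum key
  rw [Finset.sum_sub_distrib, hsum, ← Finset.sum_mul, Finset.sum_add_distrib] at h3
  refine le_trans ?_ h3
  have h4 : (∑ k ∈ Finset.range (n + 1), w k * Real.exp (m / 2 * ((k : ℝ) - n * q)) +
      ∑ k ∈ Finset.range (n + 1), w k * Real.exp (-(m / 2) * ((k : ℝ) - n * q))) *
        Real.exp (-(m / 2 * (m * n))) ≤
      (Real.exp (n * (m / 2) ^ 2) + Real.exp (n * (-(m / 2)) ^ 2)) *
        Real.exp (-(m / 2 * (m * n))) :=
    mul_le_mul_of_nonneg_right (add_le_add h1 h2) (Real.exp_pos _).le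
  have h5 : (Real.exp (n * (m / 2) ^ 2) + Real.exp (n * (-(m / 2)) ^ 2)) *
        Real.exp (-(m / 2 * (m * n))) = 2 * Real.exp (-(m ^ 2 / 4) * n) := by
    rw [neg_sq, ← two_mul, mul_assoc, ← Real.exp_add]; congr 2; ring
  linarith

/-- Deterministic contraction of the normalised expected bias. -/
lemma contraction (d r x X P : ℝ) (hd0 : 0 < d) (hd1 : d < 1) (hP : P = (2 + d) / 3)
    (hr : r ^ 2 * P = d) (hX : P * X = r) (hX0 : 0 < X) (h : |X - x| ≤ X / 3) :
    |X - (3 * (P * x) - (P * x) ^ 3) / 2| ≤ |X - x| * (1 - d / 9) := by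
  have hP0 : 0 < P := by rw [hP]; linarith
  -- write `x = X * u`
  obtain ⟨u, rfl⟩ : ∃ u, x = X * u := ⟨x / X, by field_simp⟩
  have hu : |1 - u| ≤ 1 / 3 := by
    rw [show X - X * u = X * (1 - u) by ring, abs_mul, abs_of_pos hX0] at h
    by_contra hc
    push Not at hc
    nlinarith
  have hPX : P ^ 3 * X ^ 2 = d := by rw [← hr, ← hX]; ring
  have hid : X - (3 * (P * (X * u)) - (P * (X * u)) ^ 3) / 2
      = (X - X * u) * (1 - d * (u + u ^ 2) / 2) := by
    have : (P * (X * u)) ^ 3 = d * X * u ^ 3 := by rw [← hPX]; ring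
    have hd : d = 3 * P - 2 := by rw [hP]; ring
    rw [this]
    have h2 : P = (2 + d) / 3 := hP
    rw [h2]
    ring_nf
  rw [hid, abs_mul]
  refine mul_le_mul_of_nonneg_left ?_ (abs_nonneg _)
  obtain ⟨h1, h2⟩ := abs_le.1 hu
  have a1 : 10 / 9 ≤ u + u ^ 2 := by nlinarith
  have a2 : u + u ^ 2 ≤ 28 / 9 := by nlinarith
  rw [abs_le]
  constructor <;> nlinarith


/-- Let `p < 1/3`, `γ > 0`, and `ε > 0` with `ε < 1/3` and
`ε² < (1−3p)/2`. For all sufficiently large `n`, if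
`(ε/4)s_eq ≤ |s_eq − s| ≤ s_eq/3`, then
`P(|s_eq − s_t| ≤ |s_eq − s|·(1 − 3ε²/2⁵) | s_{t−1} = s) ≥ 1 − n^{−γ²ε⁴p²/(2¹⁸·3²)}`. -/
theorem bias_approaches_equilibrium
    (p ε γ : ℝ) (hp0 : 0 < p) (hp : p < 1 / 3) (hγ : 0 < γ)
    (hε0 : 0 < ε) (hε1 : ε < 1 / 3) (hε2 : ε ^ 2 < (1 - 3 * p) / 2) :
    ∃ N : ℕ, ∀ n : ℕ, N ≤ n → ∀ s : ℤ,
      ε / 4 * sEq n p ≤ |sEq n p - (s : ℝ)| →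
      |sEq n p - (s : ℝ)| ≤ sEq n p / 3 →
      1 - (n : ℝ) ^ (-(γ ^ 2 * ε ^ 4 * p ^ 2 / (2 ^ 18 * 3 ^ 2))) ≤
        stepProb n p s
          (fun x => |sEq n p - (x : ℝ)| ≤ |sEq n p - (s : ℝ)| * (1 - 3 * ε ^ 2 / 2 ^ 5)) := by
  set c := γ ^ 2 * ε ^ 4 * p ^ 2 / (2 ^ 18 * 3 ^ 2) with hc
  set r := Real.sqrt ((1 - 3 * p) / (1 - p)) with hr
  have hP0 : 0 < 1 - p := by linarith
  have hd0 : 0 < 1 - 3 * p := by linarith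
  have hr0 : 0 < r := Real.sqrt_pos.2 (div_pos hd0 hP0)
  have hr2 : r ^ 2 * (1 - p) = 1 - 3 * p := by
    rw [hr, Real.sq_sqrt (div_pos hd0 hP0).le]; field_simp
  have hr1 : r < 1 := by
    by_contra hcon
    have h1 : 1 ≤ r ^ 2 := one_le_pow₀ (not_lt.1 hcon)
    nlinarith [mul_le_mul_of_nonneg_right h1 hP0.le]
  set X := r / (1 - p) with hX
  have hX0 : 0 < X := div_pos hr0 hP0
  have hPX : (1 - p) * X = r := by rw [hX]; field_simp
  have hX2 : X < 3 / 2 := by nlinarith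
  set m := ε / 4 * X * ((1 - 3 * p) / 18) / 2 with hm
  have hm0 : 0 < m := by positivity
  have hm2 : m ≤ 2 := by
    have a1 : ε / 4 * X ≤ 1 * 2 := by apply mul_le_mul <;> linarith
    have a2 : ε / 4 * X * ((1 - 3 * p) / 18) ≤ (1 * 2) * 1 := by
      apply mul_le_mul <;> linarith
    rw [hm]; linarith
  have hlim := tendsto_rpow_mul_exp_neg_mul_atTop_nhds_zero c (m ^ 2 / 4) (by positivity)
  have hev := (hlim.comp tendsto_natCast_atTop_atTop).eventually
    (gt_mem_nhds (show (0 : ℝ) < 1 / 2 by norm_num))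
  obtain ⟨N, hN⟩ := Filter.eventually_atTop.1 hev
  refine ⟨max N 1, fun n hn s hs1 hs2 => ?_⟩
  have hn1 : 1 ≤ n := le_trans (le_max_right _ _) hn
  have hn0 : (0 : ℝ) < n := by exact_mod_cast hn1
  have hexp := hN n (le_trans (le_max_left _ _) hn)
  simp only [Function.comp] at hexp
  have hsE : sEq n p = n * X := by rw [sEq, ← hr, hX]; ring
  obtain ⟨x, hx⟩ : ∃ x : ℝ, (s : ℝ) = n * x := ⟨s / n, by field_simp⟩
  rw [hsE, hx, ← mul_sub, abs_mul, abs_of_pos hn0] at hs1 hs2 ⊢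
  have g1 : ε / 4 * X ≤ |X - x| := by
    refine le_of_mul_le_mul_left ?_ hn0
    linarith
  have g2 : |X - x| ≤ X / 3 := by
    refine le_of_mul_le_mul_left ?_ hn0
    linarith
  have hq : qStep n p s = (2 + 3 * ((1 - p) * x) - ((1 - p) * x) ^ 3) / 4 := by
    rw [qStep, hx]; field_simp; ring
  set y := (1 - p) * x with hy
  have hy1 : 0 < y := by
    have := (abs_le.1 g2).2
    exact mul_pos hP0 (by linarith)
  have hy2 : y < 2 := by
    have := (abs_le.1 g2).1
    have : (1 - p) * x ≤ (1 - p) * (4 / 3 * X) := by gcongr; linarith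
    have e : (1 - p) * (4 / 3 * X) = 4 / 3 * r := by rw [← hPX]; ring
    rw [hy]; linarith
  have hq0 : 0 ≤ qStep n p s := by
    rw [hq, show (2 + 3 * y - y ^ 3) / 4 = (1 + y) ^ 2 * (2 - y) / 4 by ring]
    have : 0 ≤ 2 - y := by linarith
    positivity
  have hq1 : qStep n p s ≤ 1 := by
    have : 1 - (2 + 3 * y - y ^ 3) / 4 = (1 - y) ^ 2 * (2 + y) / 4 := by ring
    have : 0 ≤ (1 - y) ^ 2 * (2 + y) / 4 := by positivity
    rw [hq]; linarith
  have hcon := contraction (1 - 3 * p) r x X (1 - p) hd0 (by linarith) (by ring) hr2 hPX hX0 g2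
  rw [← hy] at hcon
  have hmain := binom_conc n (qStep n p s) m hq0 hq1 hm0.le hm2
    (fun k => |n * X - ((2 * (k : ℤ) - (n : ℤ) : ℤ) : ℝ)| ≤
      n * |X - x| * (1 - 3 * ε ^ 2 / 2 ^ 5)) (by
    intro k hk
    push_cast
    have e : n * X - (2 * (k : ℝ) - n) = n * (X - (3 * y - y ^ 3) / 2)
        + (-2) * ((k : ℝ) - n * qStep n p s) := by rw [hq]; ring
    rw [e]
    refine (abs_add_le _ _).trans ?_
    rw [abs_mul, abs_mul, abs_of_pos hn0, abs_neg, abs_two]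
    have b1 : n * |X - (3 * y - y ^ 3) / 2| ≤ n * (|X - x| * (1 - (1 - 3 * p) / 9)) := by gcongr
    have b2 : 2 * m ≤ |X - x| * ((1 - 3 * p) / 18) := by
      have : 2 * m = ε / 4 * X * ((1 - 3 * p) / 18) := by rw [hm]; ring
      rw [this]; gcongr
    have b3 : |X - x| * (1 - (1 - 3 * p) / 9) + |X - x| * ((1 - 3 * p) / 18) ≤
        |X - x| * (1 - 3 * ε ^ 2 / 2 ^ 5) := by
      rw [← mul_add]
      refine mul_le_mul_of_nonneg_left ?_ (abs_nonneg _)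
      linarith
    have b4 := mul_le_mul_of_nonneg_left b2 hn0.le
    have b5 := mul_le_mul_of_nonneg_left b3 hn0.le
    linarith)
  have hfin : 2 * Real.exp (-(m ^ 2 / 4) * n) ≤ (n : ℝ) ^ (-c) := by
    rw [Real.rpow_neg hn0.le]
    have hpos : 0 < (n : ℝ) ^ c := Real.rpow_pos_of_pos hn0 c
    rw [← one_div, le_div_iff₀ hpos]
    linarith
  refine le_trans (by linarith) (hmain.trans (le_of_eq ?_))
  rw [stepProb]
  refine Finset.sum_congr rfl fun k _ => ?_
  simp only [binomProb]
end

section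
/- Let p > 1/3 and let ε > 0 be a constant with ε < 1−p. For the 3-Majority dynamics with uniform noise probability p, if s is a bias value with s ≥ 2·√n/ε², then E[ |s_t| | s_{t−1} = s ] ≤ E[ s_t | s_{t−1} = s ]·(1 + ε/2). -/
lemma binom_moments (n : ℕ) (p : ℝ) (s : ℤ) :
    (∑ k ∈ Finset.range (n + 1), binomProb n p s k = 1) ∧
    (∑ k ∈ Finset.range (n + 1), (k : ℝ) * binomProb n p s k = n * qStep n p s) ∧
    (∑ k ∈ Finset.range (n + 1), ((n : ℝ) * qStep n p s - k) ^ 2 * binomProb n p s k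
      = n * qStep n p s * (1 - qStep n p s)) := by
  have key : ∀ k, (bernsteinPolynomial ℝ n k).eval (qStep n p s) = binomProb n p s k := by
    intro k
    simp [bernsteinPolynomial, binomProb]
  refine ⟨?_, ?_, ?_⟩
  · have h := congrArg (Polynomial.eval (qStep n p s)) (bernsteinPolynomial.sum ℝ n)
    simpa [Polynomial.eval_finsetSum, key] using h
  · have h := congrArg (Polynomial.eval (qStep n p s)) (bernsteinPolynomial.sum_smul ℝ n)
    simpa [Polynomial.eval_finsetSum, key] using h
  · have h := congrArg (Polynomial.eval (qStep n p s)) (bernsteinPolynomial.variance ℝ n)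
    simpa [Polynomial.eval_finsetSum, key] using h

/-- Let `p > 1/3` and `0 < ε < 1−p`. If `s ≥ 2√n/ε²`, then
`E[|s_t| | s_{t−1} = s] ≤ E[s_t | s_{t−1} = s]·(1 + ε/2)`. -/
theorem expected_abs_bias_bound
    (p ε : ℝ) (hp1 : 1 / 3 < p) (hp2 : p < 1)
    (hε0 : 0 < ε) (hε : ε < 1 - p)
    (n : ℕ) (s : ℤ)
    (hs : 2 * Real.sqrt n / ε ^ 2 ≤ (s : ℝ)) (hsn : s ≤ (n : ℤ)) :
    stepExp n p s (fun x => |(x : ℝ)|) ≤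
      stepExp n p s (fun x => (x : ℝ)) * (1 + ε / 2) := by
  rcases Nat.eq_zero_or_pos n with rfl | hn
  · simp [stepExp]
  have hnR : (0 : ℝ) < n := by exact_mod_cast hn
  have hsnR : (s : ℝ) ≤ n := by exact_mod_cast hsn
  have hr : 0 < Real.sqrt n := Real.sqrt_pos.mpr hnR
  have hr2 : Real.sqrt n ^ 2 = n := Real.sq_sqrt hnR.le
  have hs0 : (0 : ℝ) < s := lt_of_lt_of_le (by positivity) hs
  obtain ⟨m0, m1, m2⟩ := binom_moments n p s
  set q := qStep n p s with hq
  obtain ⟨d, hd⟩ : ∃ d : ℝ, d = s * (1 - p) / n := ⟨_, rfl⟩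
  have hnd : n * d = s * (1 - p) := by rw [hd]; field_simp
  have hd0 : 0 < d := by rw [hd]; have : 0 < 1 - p := by linarith
                         positivity
  have hd1 : d ≤ 1 := by
    rw [hd, div_le_one hnR]; nlinarith
  have hqd : 2 * q - 1 = d * (3 - d ^ 2) / 2 := by
    rw [hq, hd, qStep]; field_simp; ring
  have hd2 : d ^ 2 ≤ 1 := by nlinarith
  have hm1 : d ≤ 2 * q - 1 := by rw [hqd]; nlinarith
  have hm2 : 2 * q - 1 ≤ 1 := by
    rw [hqd]; nlinarith [mul_nonneg (sq_nonneg (d - 1)) (by linarith : 0 ≤ d + 2)]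
  have hpos : ∀ k, 0 ≤ binomProb n p s k := by
    intro k
    have h1 : 0 ≤ q := by linarith
    have h2 : 0 ≤ 1 - q := by linarith
    unfold binomProb
    rw [← hq]
    positivity
  obtain ⟨μ, hμ⟩ : ∃ μ : ℝ, μ = n * (2 * q - 1) := ⟨_, rfl⟩
  have hμs : s * ε ≤ μ := by
    have : n * d ≤ μ := by rw [hμ]; exact mul_le_mul_of_nonneg_left hm1 hnR.le
    nlinarith
  have hsε : 2 * Real.sqrt n ≤ s * ε * ε := by
    rw [div_le_iff₀ (by positivity)] at hs; linarith
  have hμ0 : 0 < μ := lt_of_lt_of_le (by positivity) hμs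
  have hμε : 2 * Real.sqrt n ≤ μ * ε := le_trans hsε (mul_le_mul_of_nonneg_right hμs hε0.le)
  have hε1 : ε < 1 := by linarith
  have hnμ : (n : ℝ) ≤ μ ^ 2 * ε := by
    have h1 : (2 * Real.sqrt n) ^ 2 ≤ (μ * ε) ^ 2 := pow_le_pow_left₀ (by positivity) hμε 2
    have h2 : (μ * ε) ^ 2 ≤ μ ^ 2 * ε := by
      have : 0 ≤ μ ^ 2 * ε * (1 - ε) := mul_nonneg (by positivity) (by linarith)
      nlinarith
    nlinarith
  have hE1 : stepExp n p s (fun x => (x : ℝ)) = μ := by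
    have : stepExp n p s (fun x => (x : ℝ)) =
        2 * (∑ k ∈ Finset.range (n + 1), (k : ℝ) * binomProb n p s k)
        - n * ∑ k ∈ Finset.range (n + 1), binomProb n p s k := by
      rw [stepExp, Finset.mul_sum, Finset.mul_sum, ← Finset.sum_sub_distrib]
      refine Finset.sum_congr rfl fun k _ => ?_
      push_cast; ring
    rw [this, m0, m1, hμ]; ring
  have hE2 : 2 * μ * stepExp n p s (fun x => |(x : ℝ)|) ≤
      4 * (n * q * (1 - q)) + 2 * μ ^ 2 := by
    have h1 : 2 * μ * stepExp n p s (fun x => |(x : ℝ)|) ≤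
        4 * (∑ k ∈ Finset.range (n + 1), ((n : ℝ) * q - k) ^ 2 * binomProb n p s k)
        + 4 * μ * (∑ k ∈ Finset.range (n + 1), (k : ℝ) * binomProb n p s k)
        + (2 * μ ^ 2 - 4 * μ * (n * q)) * ∑ k ∈ Finset.range (n + 1), binomProb n p s k := by
      rw [stepExp, Finset.mul_sum, Finset.mul_sum, Finset.mul_sum, Finset.mul_sum,
        ← Finset.sum_add_distrib, ← Finset.sum_add_distrib]
      refine Finset.sum_le_sum fun k _ => ?_
      push_cast
      have h3 : 2 * μ * |2 * (k : ℝ) - n| ≤ (2 * (k : ℝ) - n) ^ 2 + μ ^ 2 := by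
        nlinarith [sq_nonneg (|2 * (k : ℝ) - n| - μ), sq_abs (2 * (k : ℝ) - n)]
      have h4 : (2 * (k : ℝ) - n) ^ 2 + μ ^ 2 = 4 * (n * q - k) ^ 2 + 4 * μ * k
          + (2 * μ ^ 2 - 4 * μ * (n * q)) := by
        rw [hμ]; ring
      have h5 := mul_le_mul_of_nonneg_right (h3.trans_eq h4) (hpos k)
      linarith
    rw [m0, m1, m2] at h1
    linarith
  rw [hE1]
  have hV : 4 * (n * q * (1 - q)) ≤ n := by
    have h := mul_nonneg hnR.le (sq_nonneg (2 * q - 1))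
    ring_nf at h ⊢
    linarith
  have hfin : 2 * μ * stepExp n p s (fun x => |(x : ℝ)|) ≤ 2 * μ * (μ * (1 + ε / 2)) := by
    have h : 2 * μ * (μ * (1 + ε / 2)) = 2 * μ ^ 2 + μ ^ 2 * ε := by ring
    linarith
  exact le_of_mul_le_mul_left hfin (by positivity)
end
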